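/- arXiv:2502.09363 — 7 statements merged into one kernel-verified Lean document; each statement's English description precedes it below -/
import Mathlib

section
/- Let d_e > 0, d_q > 0 and γ ∈ (0,1] with d_q ≥ γ·d_e. Then ∫₀^{d_e+d_q} F(t) dt = (2γ + 1)·d_e − 2γ²·d_e²/d_q, where F is the label-accuracy function. -/
open Real

/-- The overlap between the event interval `[t - d_e, t]` and the query segment `[0, d_q]`. -/
noncomputable def overlap (d_e d_q t : ℝ) : ℝ :=
  max 0 (min (min t d_q) (min d_e (d_e + d_q - t)))

/-- The label-accuracy function: `ov t / d_q` when the annotator gives a presence label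
(overlap at least `γ * d_e`), and `1 - ov t / d_q` otherwise (absence label). -/
noncomputable def labelAcc (d_e d_q γ t : ℝ) : ℝ :=
  if γ * d_e ≤ overlap d_e d_q t then overlap d_e d_q t / d_q
  else 1 - overlap d_e d_q t / d_q

theorem overlap_eq_left {d_e d_q t : ℝ} (h0 : 0 ≤ t) (he : t ≤ d_e) (hq : t ≤ d_q) :
    overlap d_e d_q t = t := by
  unfold overlap
  grind

theorem overlap_eq_min {d_e d_q t : ℝ} (h0 : 0 ≤ min d_e d_q) (hl : min d_e d_q ≤ t)
    (hr : t ≤ max d_e d_q) : overlap d_e d_q t = min d_e d_q := by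
  unfold overlap
  grind

theorem overlap_eq_right {d_e d_q t : ℝ} (he : d_e ≤ t) (hq : d_q ≤ t) (h0 : t ≤ d_e + d_q) :
    overlap d_e d_q t = d_e + d_q - t := by
  unfold overlap
  grind

theorem integral_of_eqOn_affine {f : ℝ → ℝ} {a b p q : ℝ} (hab : a ≤ b)
    (hf : ∀ t ∈ Set.Ioo a b, f t = p + q * t) :
    IntervalIntegrable f MeasureTheory.volume a b ∧
      ∫ t in a..b, f t = p * (b - a) + q * ((b ^ 2 - a ^ 2) / 2) := by
  have hc : Continuous fun t : ℝ => p + q * t := by fun_prop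
  constructor
  · refine (hc.intervalIntegrable a b).congr_uIoo fun t ht => ?_
    rw [Set.uIoo_of_le hab] at ht
    exact (hf t ht).symm
  · rw [intervalIntegral.integral_congr_Ioo_of_le hab hf,
      intervalIntegral.integral_add intervalIntegrable_const
        (Continuous.intervalIntegrable (by fun_prop) a b),
      intervalIntegral.integral_const_mul, integral_id, intervalIntegral.integral_const]
    simp [mul_comm]

theorem integral_labelAcc_of_ge (d_e d_q γ : ℝ) (hde : 0 < d_e) (hdq : 0 < d_q)
    (hγ : γ ∈ Set.Ioc (0 : ℝ) 1) (h : γ * d_e ≤ d_q) :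
    ∫ t in (0 : ℝ)..(d_e + d_q), labelAcc d_e d_q γ t
      = (2 * γ + 1) * d_e - 2 * γ ^ 2 * d_e ^ 2 / d_q := by
  obtain ⟨hγ0, hγ1⟩ := hγ
  set c := γ * d_e with hc
  set m := min d_e d_q
  set M := max d_e d_q
  have hc0 : 0 < c := mul_pos hγ0 hde
  have hcm : c ≤ m := le_min (mul_le_of_le_one_left hde.le hγ1) h
  have hmM : m ≤ M := min_le_max
  have hsum : m + M = d_e + d_q := min_add_max d_e d_q
  have hprod : m * M = d_e * d_q := min_mul_max d_e d_q
  have hme : m ≤ d_e := min_le_left _ _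
  have hmq : m ≤ d_q := min_le_right _ _
  have heM : d_e ≤ M := le_max_left _ _
  have hqM : d_q ≤ M := le_max_right _ _
  obtain ⟨i₁, e₁⟩ := integral_of_eqOn_affine (f := labelAcc d_e d_q γ) (p := 1) (q := -1 / d_q)
    hc0.le fun t ⟨hl, hr⟩ => by
      rw [labelAcc, overlap_eq_left hl.le (by linarith) (by linarith), if_neg (by linarith)]
      ring
  obtain ⟨i₂, e₂⟩ := integral_of_eqOn_affine (f := labelAcc d_e d_q γ) (p := 0) (q := 1 / d_q)
    hcm fun t ⟨hl, hr⟩ => by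
      rw [labelAcc, overlap_eq_left (by linarith) (by linarith) (by linarith), if_pos hl.le]
      ring
  obtain ⟨i₃, e₃⟩ := integral_of_eqOn_affine (f := labelAcc d_e d_q γ) (p := m / d_q) (q := 0)
    hmM fun t ⟨hl, hr⟩ => by
      rw [labelAcc, overlap_eq_min (hc0.le.trans hcm) hl.le hr.le, if_pos hcm]
      ring
  obtain ⟨i₄, e₄⟩ := integral_of_eqOn_affine (f := labelAcc d_e d_q γ)
    (a := M) (b := d_e + d_q - c) (p := (d_e + d_q) / d_q) (q := -1 / d_q)
    (by linarith) fun t ⟨hl, hr⟩ => by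
      rw [labelAcc, overlap_eq_right (by linarith) (by linarith) (by linarith),
        if_pos (by linarith)]
      ring
  obtain ⟨i₅, e₅⟩ := integral_of_eqOn_affine (f := labelAcc d_e d_q γ)
    (a := d_e + d_q - c) (b := d_e + d_q) (p := 1 - (d_e + d_q) / d_q) (q := 1 / d_q)
    (by linarith) fun t ⟨hl, hr⟩ => by
      rw [labelAcc, overlap_eq_right (by linarith) (by linarith) (by linarith),
        if_neg (by linarith)]
      ring
  rw [← intervalIntegral.integral_add_adjacent_intervals
      (((i₁.trans i₂).trans i₃).trans i₄) i₅,
    ← intervalIntegral.integral_add_adjacent_intervals ((i₁.trans i₂).trans i₃) i₄,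
    ← intervalIntegral.integral_add_adjacent_intervals (i₁.trans i₂) i₃,
    ← intervalIntegral.integral_add_adjacent_intervals i₁ i₂, e₁, e₂, e₃, e₄, e₅]
  have hMeq : M = d_e + d_q - m := by linarith
  have hquad : m * (d_e + d_q - m) = d_e * d_q := hMeq ▸ hprod
  rw [hMeq, hc]
  field_simp
  linear_combination 2 * hquad
end

section
/- Let d_e > 0, d_q > 0 and γ ∈ (0,1] with d_q < γ·d_e. Then ∫₀^{d_e+d_q} F(t) dt = d_q, where F is the label-accuracy function. -/
open Real

theorem continuous_overlap (d_e d_q : ℝ) : Continuous (overlap d_e d_q) := by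
  unfold overlap
  fun_prop

theorem overlap_le_right {d_e d_q : ℝ} (hdq : 0 ≤ d_q) (t : ℝ) : overlap d_e d_q t ≤ d_q :=
  max_le hdq ((min_le_left _ _).trans (min_le_right _ _))

theorem integral_overlap {d_e d_q : ℝ} (hdq : 0 ≤ d_q) (hle : d_q ≤ d_e) :
    ∫ t in (0 : ℝ)..(d_e + d_q), overlap d_e d_q t = d_e * d_q := by
  have hint (a b : ℝ) : IntervalIntegrable (overlap d_e d_q) MeasureTheory.volume a b :=
    (continuous_overlap d_e d_q).intervalIntegrable a b
  have rise : ∫ t in (0 : ℝ)..d_q, overlap d_e d_q t = ∫ t in (0 : ℝ)..d_q, t := by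
    refine intervalIntegral.integral_congr fun t ht => ?_
    rw [Set.uIcc_of_le hdq] at ht
    obtain ⟨h₀, h₁⟩ := ht
    simp only [overlap]
    rw [min_eq_left h₁, min_eq_left (le_min (by linarith) (by linarith)), max_eq_right h₀]
  have plateau : ∫ t in d_q..d_e, overlap d_e d_q t = ∫ _ in d_q..d_e, d_q := by
    refine intervalIntegral.integral_congr fun t ht => ?_
    rw [Set.uIcc_of_le hle] at ht
    obtain ⟨h₀, h₁⟩ := ht
    simp only [overlap]
    rw [min_eq_right h₀, min_eq_left (le_min hle (by linarith)), max_eq_right hdq]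
  have fall : ∫ t in d_e..(d_e + d_q), overlap d_e d_q t =
      ∫ t in d_e..(d_e + d_q), (d_e + d_q - t) := by
    refine intervalIntegral.integral_congr fun t ht => ?_
    rw [Set.uIcc_of_le (by linarith)] at ht
    obtain ⟨h₀, h₁⟩ := ht
    simp only [overlap]
    rw [min_eq_right (by linarith : d_e + d_q - t ≤ d_e),
      min_eq_right (le_min (by linarith) (by linarith)), max_eq_right (by linarith)]
  rw [← intervalIntegral.integral_add_adjacent_intervals (hint 0 d_e) (hint d_e _),
    ← intervalIntegral.integral_add_adjacent_intervals (hint 0 d_q) (hint d_q _),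
    rise, plateau, fall, intervalIntegral.integral_sub (by simp) (by simp)]
  simp only [integral_id, intervalIntegral.integral_const, smul_eq_mul]
  ring

theorem labelAcc_of_lt {d_e d_q γ : ℝ} (hdq : 0 ≤ d_q) (h : d_q < γ * d_e) (t : ℝ) :
    labelAcc d_e d_q γ t = 1 - overlap d_e d_q t / d_q :=
  if_neg ((overlap_le_right hdq t).trans_lt h).not_ge

theorem integral_labelAcc_of_lt (d_e d_q γ : ℝ) (hde : 0 < d_e) (hdq : 0 < d_q)
    (hγ : γ ∈ Set.Ioc (0 : ℝ) 1) (h : d_q < γ * d_e) :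
    ∫ t in (0 : ℝ)..(d_e + d_q), labelAcc d_e d_q γ t = d_q := by
  have hle : d_q ≤ d_e := h.le.trans (mul_le_of_le_one_left hde.le hγ.2)
  simp only [labelAcc_of_lt hdq.le h]
  rw [intervalIntegral.integral_sub (by simp)
      (((continuous_overlap d_e d_q).div_const d_q).intervalIntegrable _ _),
    intervalIntegral.integral_div, integral_overlap hdq.le hle]
  simp [hdq.ne']
end

section
/- Let d_e > 0 and γ ∈ (0,1], and set d_q* = d_e·γ·(2γ + √(4γ² + 4γ + 2))/(2γ + 1). Then d_q* > γ·d_e, and for every d_q > 0 the expected label accuracy given overlap satisfies f(d_q) ≤ f(d_q*); that is, d_q* is the query segment length that maximizes the expected label accuracy given overlap. -/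
open Real

/-- The expected label accuracy given overlap, as a function of the query segment length
`d_q`, for event length `d_e` and annotator presence criterion `γ`. -/
noncomputable def expAcc (d_e γ d_q : ℝ) : ℝ :=
  if γ * d_e ≤ d_q then d_e * (2 * γ * d_q - 2 * γ ^ 2 * d_e + d_q) / (d_q * (d_e + d_q))
  else d_q / (d_e + d_q)

/-- A point `x` satisfying the first-order condition maximizes the upper branch of `expAcc`. -/
theorem upper_branch_le_of_critical {e γ x q : ℝ} (he : 0 < e) (hx : 0 < x) (hq : 0 < q)
    (hpos : 0 ≤ (2 * γ + 1) * x - 2 * γ ^ 2 * e)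
    (hcrit : (2 * γ + 1) * x ^ 2 = 4 * γ ^ 2 * e * x + 2 * γ ^ 2 * e ^ 2) :
    e * (2 * γ * q - 2 * γ ^ 2 * e + q) / (q * (e + q)) ≤
      e * (2 * γ * x - 2 * γ ^ 2 * e + x) / (x * (e + x)) := by
  rw [div_le_div_iff₀ (by positivity) (by positivity)]
  have hsq : 0 ≤ e * (((2 * γ + 1) * x - 2 * γ ^ 2 * e) * (q - x) ^ 2) := by positivity
  linear_combination hsq + e * (x - q) * hcrit

theorem optimal_query_length (d_e γ : ℝ) (hde : 0 < d_e) (hγ : γ ∈ Set.Ioc (0 : ℝ) 1) :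
    let dqstar := d_e * γ * (2 * γ + Real.sqrt (4 * γ ^ 2 + 4 * γ + 2)) / (2 * γ + 1)
    γ * d_e < dqstar ∧ ∀ d_q : ℝ, 0 < d_q → expAcc d_e γ d_q ≤ expAcc d_e γ dqstar := by
  intro x
  obtain ⟨hγ0, hγ1⟩ := hγ
  have hs2 : √(4 * γ ^ 2 + 4 * γ + 2) ^ 2 = 4 * γ ^ 2 + 4 * γ + 2 := Real.sq_sqrt (by positivity)
  have hs1 : 1 < √(4 * γ ^ 2 + 4 * γ + 2) := Real.lt_sqrt_of_sq_lt (by nlinarith)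
  have hxc : (2 * γ + 1) * x = d_e * γ * (2 * γ + √(4 * γ ^ 2 + 4 * γ + 2)) :=
    mul_div_cancel₀ _ (by positivity)
  set s := √(4 * γ ^ 2 + 4 * γ + 2)
  have heγ : 0 < d_e * γ := by positivity
  have hlt : γ * d_e < x := by
    have : (2 * γ + 1) * (γ * d_e) < (2 * γ + 1) * x := by nlinarith
    exact lt_of_mul_lt_mul_left this (by positivity)
  have hx : 0 < x := by nlinarith
  have hcrit : (2 * γ + 1) * x ^ 2 = 4 * γ ^ 2 * d_e * x + 2 * γ ^ 2 * d_e ^ 2 := by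
    have hc : 2 * γ + 1 ≠ 0 := by positivity
    apply mul_left_cancel₀ hc
    linear_combination ((2 * γ + 1) * x + d_e * γ * (2 * γ + s) - 4 * γ ^ 2 * d_e) * hxc +
      d_e ^ 2 * γ ^ 2 * hs2
  have hpos : 0 ≤ (2 * γ + 1) * x - 2 * γ ^ 2 * d_e := by
    rw [hxc]
    nlinarith
  refine ⟨hlt, fun q hq => ?_⟩
  have hupper : ∀ {y : ℝ}, 0 < y → _ := fun hy =>
    upper_branch_le_of_critical hde hx hy hpos hcrit
  unfold expAcc
  rw [if_pos hlt.le]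
  split_ifs with h
  · exact hupper hq
  · refine le_trans ?_ (hupper (y := γ * d_e) (by positivity))
    have hedge : d_e * (2 * γ * (γ * d_e) - 2 * γ ^ 2 * d_e + γ * d_e) /
        (γ * d_e * (d_e + γ * d_e)) = d_e / (d_e + γ * d_e) := by
      field_simp
      ring
    rw [hedge, div_le_div_iff₀ (by positivity) (by positivity)]
    have hqe : q ≤ d_e := by nlinarith
    have hqγ : q * γ ≤ 1 * q := by nlinarith
    nlinarith
end

section
/- Let d_e > 0, γ ∈ (0,1], T > 0, and set d_q* = d_e·γ·(2γ + √(4γ² + 4γ + 2))/(2γ + 1) and B*_FIX = T/d_q*. Then the FIX query segment length T/B*_FIX equals d_q*, and hence for every d_q > 0 one has f(d_q) ≤ f(T/B*_FIX); that is, using B*_FIX query segments for a recording of length T maximizes the expected label accuracy given overlap. -/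
open Real

/-- On the branch `γ * d ≤ q`, the accuracy is at most its value at a point `p` satisfying
the first-order condition `(2 * γ + 1) * p ^ 2 = 2 * γ ^ 2 * d * (2 * p + d)`. -/
lemma accuracy_le_of_critical {d γ p q : ℝ} (hd : 0 < d) (hγ : 0 < γ) (hp : γ * d ≤ p)
    (hq : 0 < q) (hcrit : (2 * γ + 1) * p ^ 2 = 2 * γ ^ 2 * d * (2 * p + d)) :
    d * (2 * γ * q - 2 * γ ^ 2 * d + q) / (q * (d + q)) ≤
      d * (2 * γ * p - 2 * γ ^ 2 * d + p) / (p * (d + p)) := by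
  have hp0 : 0 < p := (mul_pos hγ hd).trans_le hp
  have hnum : 0 ≤ 2 * γ * p - 2 * γ ^ 2 * d + p := by nlinarith
  rw [div_le_div_iff₀ (by positivity) (by positivity)]
  have hsq : 0 ≤ d * ((2 * γ * p - 2 * γ ^ 2 * d + p) * (q - p) ^ 2) := by positivity
  linear_combination hsq + d * (p - q) * hcrit

theorem optimal_number_of_queries (d_e γ T : ℝ) (hde : 0 < d_e) (hγ : γ ∈ Set.Ioc (0 : ℝ) 1)
    (hT : 0 < T) :
    let dqstar := d_e * γ * (2 * γ + Real.sqrt (4 * γ ^ 2 + 4 * γ + 2)) / (2 * γ + 1)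
    let Bstar := T / dqstar
    T / Bstar = dqstar ∧ ∀ d_q : ℝ, 0 < d_q → expAcc d_e γ d_q ≤ expAcc d_e γ (T / Bstar) := by
  intro p B
  obtain ⟨hγ0, hγ1⟩ := hγ
  have hTB : T / B = p := div_div_cancel₀ hT.ne'
  refine ⟨hTB, fun q hq => ?_⟩
  rw [hTB]
  have hs : √(4 * γ ^ 2 + 4 * γ + 2) ^ 2 = 4 * γ ^ 2 + 4 * γ + 2 := Real.sq_sqrt (by positivity)
  have hs1 : 1 ≤ √(4 * γ ^ 2 + 4 * γ + 2) := Real.one_le_sqrt.mpr (by nlinarith)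
  have hγd : 0 < γ * d_e := mul_pos hγ0 hde
  have hp : γ * d_e ≤ p := by
    rw [le_div_iff₀ (by positivity)]
    nlinarith
  have hcrit : (2 * γ + 1) * p ^ 2 = 2 * γ ^ 2 * d_e * (2 * p + d_e) := by
    simp only [p]
    generalize √(4 * γ ^ 2 + 4 * γ + 2) = s at hs ⊢
    field_simp
    linear_combination hs
  unfold expAcc
  rw [if_pos hp]
  split_ifs with h
  · exact accuracy_le_of_critical hde hγ0 hp hq hcrit
  · refine le_trans ?_ (accuracy_le_of_critical hde hγ0 hp hγd hcrit)
    rw [not_le] at h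
    have hval : d_e * (2 * γ * (γ * d_e) - 2 * γ ^ 2 * d_e + γ * d_e) /
        (γ * d_e * (d_e + γ * d_e)) = 1 / (1 + γ) := by
      field_simp
      ring
    rw [hval, div_le_div_iff₀ (by positivity) (by positivity)]
    nlinarith
end

section
/- Let d_e > 0, d_q > 0, γ ∈ (0,1] with d_q ≥ γ·d_e, let M ≥ 0 be a real number (number of events) and T > 0 with T ≥ M·(d_e + d_q). Then, with A = ∫₀^{d_e+d_q} F(t) dt, the expected label accuracy of the whole recording satisfies (M·A + (T − M·(d_e + d_q)))/T = −2M·d_e²·γ²/(T·d_q) + 2M·d_e·γ/T − M·d_q/T + 1. -/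
open Real

/-- A function that is affine on an open interval is integrable there, with the expected value. -/
lemma intervalIntegrable_and_integral_eq_of_affine {f : ℝ → ℝ} {a b p q : ℝ} (hab : a ≤ b)
    (hf : ∀ t ∈ Set.Ioo a b, f t = p + q * t) :
    IntervalIntegrable f MeasureTheory.volume a b ∧
      ∫ t in a..b, f t = p * (b - a) + q * (b ^ 2 - a ^ 2) / 2 := by
  have hfi : IntervalIntegrable (fun t : ℝ => p + q * t) MeasureTheory.volume a b :=
    Continuous.intervalIntegrable (by fun_prop) a b
  have heq : (Set.Ioo a b).EqOn (fun t => p + q * t) f := fun t ht => (hf t ht).symm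
  refine ⟨hfi.congr_uIoo (Set.uIoo_of_le hab ▸ heq), ?_⟩
  rw [← intervalIntegral.integral_congr_Ioo_of_le hab heq, intervalIntegral.integral_add (by simp)
    (Continuous.intervalIntegrable (by fun_prop) a b), intervalIntegral.integral_const,
    intervalIntegral.integral_const_mul, integral_id, smul_eq_mul]
  ring

lemma overlap_eq_self {d_e d_q t : ℝ} (h₀ : 0 ≤ t) (he : t ≤ d_e) (hq : t ≤ d_q) :
    overlap d_e d_q t = t := by
  rw [overlap, min_eq_left hq, min_eq_left (le_min he (by linarith)), max_eq_right h₀]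

lemma overlap_symm (d_e d_q t : ℝ) : overlap d_e d_q (d_e + d_q - t) = overlap d_e d_q t := by
  unfold overlap
  grind

lemma overlap_eq_min_s8 {d_e d_q t : ℝ} (hde : 0 ≤ d_e) (hdq : 0 ≤ d_q) (h₁ : min d_e d_q ≤ t)
    (h₂ : t ≤ d_e + d_q - min d_e d_q) : overlap d_e d_q t = min d_e d_q := by
  unfold overlap
  grind

/-- The integral of the label accuracy over all cases in which event and query overlap. -/
lemma integral_labelAcc {d_e d_q γ : ℝ} (hde : 0 < d_e) (hdq : 0 < d_q)
    (hγ : γ ∈ Set.Ioc (0 : ℝ) 1) (h : γ * d_e ≤ d_q) :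
    ∫ t in (0 : ℝ)..(d_e + d_q), labelAcc d_e d_q γ t
      = d_e + 2 * (γ * d_e) - 2 * (γ * d_e) ^ 2 / d_q := by
  have hg : 0 < γ * d_e := mul_pos hγ.1 hde
  have hge : γ * d_e ≤ d_e := mul_le_of_le_one_left hde.le hγ.2
  have hgm : γ * d_e ≤ min d_e d_q := le_min hge h
  have hme : min d_e d_q ≤ d_e := min_le_left _ _
  have hmq : min d_e d_q ≤ d_q := min_le_right _ _
  have harea : min d_e d_q * (d_e + d_q - min d_e d_q) = d_e * d_q := by
    rcases min_choice d_e d_q with hm | hm <;> rw [hm] <;> ring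
  have hmid := fun t => overlap_eq_min_s8 (t := t) hde.le hdq.le
  have hleft : ∀ t, 0 ≤ t → t ≤ min d_e d_q → overlap d_e d_q t = t := fun t h₀ ht =>
    overlap_eq_self h₀ (ht.trans hme) (ht.trans hmq)
  have hright : ∀ t, d_e + d_q - min d_e d_q ≤ t → t ≤ d_e + d_q →
      overlap d_e d_q t = d_e + d_q - t := fun t ht h₀ => by
    rw [← overlap_symm, hleft _ (by linarith) (by linarith)]
  have hpres : ∀ t, γ * d_e ≤ overlap d_e d_q t →
      labelAcc d_e d_q γ t = overlap d_e d_q t / d_q := fun t ht => if_pos ht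
  have habs : ∀ t, overlap d_e d_q t < γ * d_e →
      labelAcc d_e d_q γ t = 1 - overlap d_e d_q t / d_q := fun t ht => if_neg ht.not_ge
  generalize min d_e d_q = m at *
  generalize γ * d_e = g at *
  obtain ⟨i₁, e₁⟩ := intervalIntegrable_and_integral_eq_of_affine (f := labelAcc d_e d_q γ)
    (a := 0) (b := g) (p := 1) (q := -(1 / d_q)) hg.le fun t ht => by
      have ho := hleft t ht.1.le (ht.2.le.trans hgm)
      rw [habs t (ho.trans_lt ht.2), ho]
      ring
  obtain ⟨i₂, e₂⟩ := intervalIntegrable_and_integral_eq_of_affine (f := labelAcc d_e d_q γ)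
    (a := g) (b := m) (p := 0) (q := 1 / d_q) hgm fun t ht => by
      have ho := hleft t (hg.trans ht.1).le ht.2.le
      rw [hpres t (ht.1.le.trans_eq ho.symm), ho]
      ring
  obtain ⟨i₃, e₃⟩ := intervalIntegrable_and_integral_eq_of_affine (f := labelAcc d_e d_q γ)
    (a := m) (b := d_e + d_q - m) (p := m / d_q) (q := 0) (by linarith) fun t ht => by
      have ho := hmid t ht.1.le ht.2.le
      rw [hpres t (hgm.trans_eq ho.symm), ho]
      ring
  obtain ⟨i₄, e₄⟩ := intervalIntegrable_and_integral_eq_of_affine (f := labelAcc d_e d_q γ)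
    (a := d_e + d_q - m) (b := d_e + d_q - g) (p := (d_e + d_q) / d_q) (q := -(1 / d_q))
    (by linarith) fun t ht => by
      have ho := hright t ht.1.le (by linarith [ht.2])
      rw [hpres t (by linarith [ht.2]), ho]
      ring
  obtain ⟨i₅, e₅⟩ := intervalIntegrable_and_integral_eq_of_affine (f := labelAcc d_e d_q γ)
    (a := d_e + d_q - g) (b := d_e + d_q) (p := 1 - (d_e + d_q) / d_q) (q := 1 / d_q)
    (by linarith) fun t ht => by
      have ho := hright t (by linarith [ht.1]) ht.2.le
      rw [habs t (by linarith [ht.1]), ho]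
      ring
  rw [← intervalIntegral.integral_add_adjacent_intervals
      (((i₁.trans i₂).trans i₃).trans i₄) i₅,
    ← intervalIntegral.integral_add_adjacent_intervals ((i₁.trans i₂).trans i₃) i₄,
    ← intervalIntegral.integral_add_adjacent_intervals (i₁.trans i₂) i₃,
    ← intervalIntegral.integral_add_adjacent_intervals i₁ i₂, e₁, e₂, e₃, e₄, e₅]
  field_simp
  linear_combination 2 * harea

theorem expected_labelAcc_recording (d_e d_q γ M T : ℝ) (hde : 0 < d_e) (hdq : 0 < d_q)
    (hγ : γ ∈ Set.Ioc (0 : ℝ) 1) (h : γ * d_e ≤ d_q) (hM : 0 ≤ M) (hT : 0 < T)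
    (hTM : M * (d_e + d_q) ≤ T) :
    (M * (∫ t in (0 : ℝ)..(d_e + d_q), labelAcc d_e d_q γ t) + (T - M * (d_e + d_q))) / T
      = -(2 * M * d_e ^ 2 * γ ^ 2) / (T * d_q) + 2 * M * d_e * γ / T - M * d_q / T + 1 := by
  rw [integral_labelAcc hde hdq hγ h]
  field_simp
  ring
end

section
/- Let d_e > 0 and define d_q*(γ) = d_e·γ·(2γ + √(4γ² + 4γ + 2))/(2γ + 1) for γ ∈ (0,1]. Then 0 < d_q*(γ) ≤ d_e·(2 + √10)/3 for all γ ∈ (0,1], with equality in the upper bound exactly at γ = 1. -/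
open Real

/-- The optimal query length is strictly below its value at `γ = 1` for `γ ∈ (0, 1)`. -/
theorem optimal_query_length_lt {d γ : ℝ} (hd : 0 < d) (h0 : 0 < γ) (h1 : γ < 1) :
    d * γ * (2 * γ + √(4 * γ ^ 2 + 4 * γ + 2)) / (2 * γ + 1) < d * (2 + √10) / 3 := by
  have hs : √(4 * γ ^ 2 + 4 * γ + 2) < √10 :=
    Real.sqrt_lt_sqrt (by positivity) (by nlinarith)
  rw [div_lt_div_iff₀ (by positivity) (by norm_num)]
  calc d * γ * (2 * γ + √(4 * γ ^ 2 + 4 * γ + 2)) * 3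
      = d * ((3 * γ) * (2 * γ + √(4 * γ ^ 2 + 4 * γ + 2))) := by ring
    _ < d * ((2 * γ + 1) * (2 + √10)) := by
        gcongr
        · linarith
        · linarith
    _ = d * (2 + √10) * (2 * γ + 1) := by ring

/-- The optimal query length at `γ = 1`. -/
theorem optimal_query_length_one (d : ℝ) :
    d * 1 * (2 * 1 + √(4 * 1 ^ 2 + 4 * 1 + 2)) / (2 * 1 + 1) = d * (2 + √10) / 3 := by
  norm_num

theorem optimal_query_length_bounds (d_e : ℝ) (hde : 0 < d_e) :
    let dqstar : ℝ → ℝ := fun γ =>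
      d_e * γ * (2 * γ + Real.sqrt (4 * γ ^ 2 + 4 * γ + 2)) / (2 * γ + 1)
    (∀ γ ∈ Set.Ioc (0 : ℝ) 1,
        0 < dqstar γ ∧ dqstar γ ≤ d_e * (2 + Real.sqrt 10) / 3) ∧
      ∀ γ ∈ Set.Ioc (0 : ℝ) 1,
        (dqstar γ = d_e * (2 + Real.sqrt 10) / 3 ↔ γ = 1) := by
  intro dqstar
  refine ⟨fun γ ⟨h0, h1⟩ => ⟨by positivity, ?_⟩, fun γ ⟨h0, h1⟩ => ⟨fun h => ?_, ?_⟩⟩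
  · rcases h1.lt_or_eq with h1 | rfl
    · exact (optimal_query_length_lt hde h0 h1).le
    · exact (optimal_query_length_one d_e).le
  · by_contra hne
    exact (optimal_query_length_lt hde h0 (h1.lt_of_ne hne)).ne h
  · rintro rfl
    exact optimal_query_length_one d_e
end

section
/- Let d_e > 0, γ ∈ (0,1], and d_q > 0 with d_q ≥ γ·d_e. Then the expected label accuracy given overlap is strictly less than 1: d_e·(2γ·d_q − 2γ²·d_e + d_q)/(d_q·(d_e + d_q)) < 1. -/
open Real

theorem expected_label_accuracy_lt_one (d_e d_q γ : ℝ) (hde : 0 < d_e)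
    (hγ : γ ∈ Set.Ioc (0 : ℝ) 1) (hdq : 0 < d_q) (h : γ * d_e ≤ d_q) :
    d_e * (2 * γ * d_q - 2 * γ ^ 2 * d_e + d_q) / (d_q * (d_e + d_q)) < 1 := by
  have hpos : 0 < γ * d_e := mul_pos hγ.1 hde
  rw [div_lt_one (by positivity)]
  linarith [sq_nonneg (d_q - γ * d_e), pow_pos hpos 2]
end
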